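/- Let W be a finite reflection group with basic invariants P₁,…,Pₙ (so R^W = ℝ[P₁,…,Pₙ]) satisfying ∑ (deg P_i − 1) = |Φ⁺| and nonvanishing Jacobian det(∂P_i/∂x_j). Then the gradients ∇P₁,…,∇Pₙ form an R-basis of the logarithmic derivation module D(𝒜_{Φ⁺}) of the Weyl arrangement; consequently the ideal { θ(Q) | θ ∈ D(𝒜_{Φ⁺}) } equals the ideal (R^W₊) generated by positive-degree invariants, where Q is a W-invariant nondegenerate quadratic form. -/

import Mathlib

open MvPolynomial

noncomputable section

/-- A polynomial vector field `θ = ∑ᵢ θᵢ ∂/∂xᵢ` applied to a polynomial `p`. -/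
def applyDer (n : ℕ) (θ : Fin n → MvPolynomial (Fin n) ℝ) (p : MvPolynomial (Fin n) ℝ) :
    MvPolynomial (Fin n) ℝ :=
  ∑ i : Fin n, θ i * pderiv i p

/-- The action of a linear automorphism `w` of `ℝⁿ` on polynomials: `(w · f)(x) = f(w x)`. -/
def polyAct (n : ℕ) (w : (Fin n → ℝ) ≃ₗ[ℝ] (Fin n → ℝ)) (f : MvPolynomial (Fin n) ℝ) :
    MvPolynomial (Fin n) ℝ :=
  aeval (fun k : Fin n => ∑ j : Fin n, C (w (Pi.single j 1) k) * X j) f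

/-- The linear form `∑ⱼ vⱼ xⱼ` with coefficient vector `v`. -/
def linForm {n : ℕ} (v : Fin n → ℝ) : MvPolynomial (Fin n) ℝ := ∑ j, C (v j) * X j

theorem pderiv_linForm {n : ℕ} (v : Fin n → ℝ) (i : Fin n) : pderiv i (linForm v) = C (v i) := by
  simp [linForm, pderiv_X, Pi.single_apply]

theorem linForm_ne_zero {n : ℕ} {v : Fin n → ℝ} (hv : v ≠ 0) : linForm v ≠ 0 := by
  intro h
  apply hv
  funext i
  have := pderiv_linForm v i
  rw [h, map_zero] at this
  simpa using this.symm

theorem isHomogeneous_linForm {n : ℕ} (v : Fin n → ℝ) : (linForm v).IsHomogeneous 1 :=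
  IsHomogeneous.sum _ _ _ fun j _ => isHomogeneous_C_mul_X (v j) j

theorem totalDegree_linForm {n : ℕ} {v : Fin n → ℝ} (hv : v ≠ 0) : (linForm v).totalDegree = 1 :=
  (isHomogeneous_linForm v).totalDegree (linForm_ne_zero hv)

theorem irreducible_linForm {n : ℕ} {v : Fin n → ℝ} (hv : v ≠ 0) : Irreducible (linForm v) := by
  refine irreducible_of_totalDegree_eq_one (totalDegree_linForm hv) fun x hx => ?_
  refine isUnit_iff_ne_zero.2 ?_
  rintro rfl
  exact linForm_ne_zero hv (MvPolynomial.ext _ _ fun d => by simpa using hx d)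

/-- If `f` is nonzero and `f ∣ g` with `deg g ≤ deg f`, then `g` is a scalar multiple of `f`. -/
theorem exists_eq_mul_C_of_dvd {n : ℕ} {f g : MvPolynomial (Fin n) ℝ} (hf : f ≠ 0) (h : f ∣ g)
    (hd : g.totalDegree ≤ f.totalDegree) : ∃ c : ℝ, g = f * C c := by
  obtain ⟨q, rfl⟩ := h
  by_cases hq : q = 0
  · exact ⟨0, by simp [hq]⟩
  · rw [totalDegree_mul_of_isDomain hf hq] at hd
    exact ⟨_, by rw [← totalDegree_eq_zero_iff_eq_C.1 (by omega : q.totalDegree = 0)]⟩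

theorem isRelPrime_linForm {n : ℕ} {v w : Fin n → ℝ} (hv : v ≠ 0) (hw : w ≠ 0)
    (h : ∀ c : ℝ, w ≠ c • v) : IsRelPrime (linForm v) (linForm w) := by
  refine (irreducible_linForm hv).isRelPrime_iff_not_dvd.2 fun hdvd => ?_
  obtain ⟨c, hc⟩ := exists_eq_mul_C_of_dvd (linForm_ne_zero hv) hdvd
    (by rw [totalDegree_linForm hv, totalDegree_linForm hw])
  refine h c (funext fun i => C_injective (Fin n) ℝ ?_)
  rw [← pderiv_linForm w i, hc, mul_comm, pderiv_C_mul, pderiv_linForm]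
  simp

theorem pderiv_aeval {σ τ R : Type*} [Fintype σ] [CommSemiring R] (g : σ → MvPolynomial τ R)
    (f : MvPolynomial σ R) (j : τ) :
    pderiv j (aeval g f) = ∑ k, aeval g (pderiv k f) * pderiv j (g k) := by
  classical
  induction f using MvPolynomial.induction_on with
  | C r => simp [algebraMap_eq]
  | add p q hp hq => simp only [map_add, hp, hq, add_mul, Finset.sum_add_distrib]
  | mul_X p i hp =>
    simp only [map_mul, aeval_X, pderiv_mul, hp, pderiv_X, map_add, add_mul,
      Finset.sum_add_distrib, Finset.sum_mul]
    congr 1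
    · exact Finset.sum_congr rfl fun k _ => by ring
    · rw [Finset.sum_eq_single i]
      · simp
      · intro k _ hk
        simp [hk.symm]
      · simp

theorem dvd_aeval_sub_self {σ R : Type*} [CommRing R] {g : σ → MvPolynomial σ R}
    {l : MvPolynomial σ R} (hg : ∀ k, l ∣ g k - X k) (f : MvPolynomial σ R) :
    l ∣ aeval g f - f := by
  induction f using MvPolynomial.induction_on with
  | C r => simp [algebraMap_eq]
  | add p q hp hq =>
    rw [map_add, add_sub_add_comm]
    exact dvd_add hp hq
  | mul_X p i hp =>
    rw [map_mul, aeval_X,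
      show aeval g p * g i - p * X i = (aeval g p - p) * g i + p * (g i - X i) by ring]
    exact dvd_add (hp.mul_right _) ((hg i).mul_left _)

/-- The derivative along a root of a polynomial invariant under the corresponding reflection
vanishes on the reflecting hyperplane. -/
theorem linForm_dvd_of_reflection_invariant {n : ℕ} {v : Fin n → ℝ} (hv : v ≠ 0)
    {s : (Fin n → ℝ) ≃ₗ[ℝ] (Fin n → ℝ)}
    (hs : ∀ x : Fin n → ℝ, s x = x - (2 * (∑ j, v j * x j) / (∑ j, v j * v j)) • v)
    {p : MvPolynomial (Fin n) ℝ} (hp : polyAct n s p = p) :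
    linForm v ∣ ∑ k, pderiv k p * C (v k) := by
  set N := ∑ j, v j * v j with hN
  have hN0 : N ≠ 0 := fun h => hv (dotProduct_self_eq_zero.1 h)
  set g : Fin n → MvPolynomial (Fin n) ℝ := fun k => linForm fun j => s (Pi.single j 1) k with hg
  have hp' : aeval g p = p := hp
  have hse : ∀ j k, s (Pi.single j 1) k = (Pi.single j 1 : Fin n → ℝ) k - 2 * v j / N * v k := by
    intro j k
    rw [hs]
    simp [Pi.single_apply]
  have hgX : ∀ k, linForm v ∣ g k - X k := by
    intro k
    refine ⟨C (-(2 / N * v k)), ?_⟩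
    simp only [hg, linForm, hse, Finset.sum_mul, map_sub, sub_mul, Finset.sum_sub_distrib]
    have : ∑ j, C ((Pi.single j 1 : Fin n → ℝ) k) * X j = (X k : MvPolynomial (Fin n) ℝ) := by
      rw [Finset.sum_eq_single k] <;> simp +contextual [eq_comm]
    rw [this, sub_sub_cancel_left, ← Finset.sum_neg_distrib]
    refine Finset.sum_congr rfl fun j _ => ?_
    rw [mul_right_comm, ← C_mul, ← neg_mul, ← C_neg]
    congr 2
    ring
  have hsum : ∀ k, ∑ j, C (v j) * pderiv j (g k) = -C (v k) := by
    intro k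
    simp only [hg, pderiv_linForm, ← C_mul, ← map_sum, ← C_neg]
    congr 1
    calc ∑ j, v j * s (Pi.single j 1) k
        = ∑ j, (v j * (Pi.single j 1 : Fin n → ℝ) k - v j * v j * (2 / N * v k)) :=
          Finset.sum_congr rfl fun j _ => by rw [hse]; ring
      _ = v k - N * (2 / N * v k) := by
          rw [Finset.sum_sub_distrib, ← Finset.sum_mul, ← hN]
          simp [Pi.single_apply]
      _ = -v k := by field_simp; ring
  set D := ∑ k, pderiv k p * C (v k) with hD
  have hDneg : aeval g D = -D := by
    have h1 : D = ∑ j, ∑ k, aeval g (pderiv k p) * pderiv j (g k) * C (v j) := by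
      simp only [hD, ← Finset.sum_mul, ← pderiv_aeval, hp']
    conv_rhs => rw [h1, Finset.sum_comm, ← Finset.sum_neg_distrib]
    rw [hD, map_sum]
    refine Finset.sum_congr rfl fun k _ => ?_
    have h2 : ∑ j, aeval g (pderiv k p) * pderiv j (g k) * C (v j)
        = aeval g (pderiv k p) * ∑ j, C (v j) * pderiv j (g k) := by
      rw [Finset.mul_sum]
      exact Finset.sum_congr rfl fun j _ => by rw [mul_assoc, mul_comm (C (v j))]
    rw [h2, hsum, map_mul, aeval_C, algebraMap_eq, mul_neg, neg_neg]
  have h2 := dvd_aeval_sub_self hgX D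
  rw [hDneg] at h2
  have h3 := h2.mul_left (C (-1 / 2))
  convert h3 using 1
  rw [show -D - D = C (-2) * D by
    rw [C_neg, show (C 2 : MvPolynomial (Fin n) ℝ) = 2 from map_ofNat C 2]; ring, ← mul_assoc, ← C_mul]
  norm_num

/-- A prime linear form divides the determinant of every square matrix whose rows it makes
logarithmic. -/
theorem dvd_det_of_dvd_mulVec {n : ℕ} {v : Fin n → ℝ} (hv : v ≠ 0)
    {l : MvPolynomial (Fin n) ℝ} (M : Matrix (Fin n) (Fin n) (MvPolynomial (Fin n) ℝ))
    (h : ∀ i, l ∣ ∑ k, M i k * C (v k)) : l ∣ M.det := by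
  obtain ⟨k, hk⟩ := Function.ne_iff.1 hv
  have h1 : M.adjugate.mulVec (M.mulVec fun k => C (v k)) = M.det • fun k => C (v k) := by
    rw [Matrix.mulVec_mulVec, Matrix.adjugate_mul, Matrix.smul_mulVec, Matrix.one_mulVec]
  have h2 : l ∣ M.det * C (v k) := by
    have := congrFun h1 k
    rw [Pi.smul_apply, smul_eq_mul] at this
    rw [← this]
    change l ∣ ∑ i, M.adjugate k i * ∑ j, M i j * C (v j)
    exact Finset.dvd_sum fun i _ => (h i).mul_left _
  have h3 := h2.mul_right (C (v k)⁻¹)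
  rwa [mul_assoc, ← C_mul, mul_inv_cancel₀ hk, C_1, mul_one] at h3

/-- The degree of the Jacobian determinant of homogeneous polynomials. -/
theorem isHomogeneous_det_jacobian {n : ℕ} {P : Fin n → MvPolynomial (Fin n) ℝ} {e : Fin n → ℕ}
    (hP : ∀ i, (P i).IsHomogeneous (e i)) :
    (Matrix.of fun i j : Fin n => pderiv j (P i)).det.IsHomogeneous (∑ i, (e i - 1)) := by
  rw [← Matrix.det_transpose, Matrix.det_apply]
  refine IsHomogeneous.sum _ _ _ fun τ _ => ?_
  have := IsHomogeneous.prod Finset.univ (fun i => pderiv (τ i) (P i)) (fun i => e i - 1)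
    fun i _ => (hP i).pderiv
  rw [Units.smul_def, ← Int.cast_smul_eq_zsmul ℝ, smul_eq_C_mul]
  simpa only [zero_add] using! (isHomogeneous_C (Fin n) _).mul this

/-- If the elements of `S` have zero constant term, then a polynomial in them agrees with its constant
term modulo the ideal they generate. -/
theorem sub_C_constantCoeff_mem_span {σ R : Type*} [CommRing R] {S : Set (MvPolynomial σ R)}
    (hS : ∀ f ∈ S, constantCoeff f = 0) {f : MvPolynomial σ R} (hf : f ∈ Algebra.adjoin R S) :
    f - C (constantCoeff f) ∈ Ideal.span S := by
  induction hf using Algebra.adjoin_induction with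
  | mem x hx => simpa [hS x hx] using Ideal.subset_span hx
  | algebraMap r => simp [algebraMap_eq]
  | add x y _ _ hx hy =>
    rw [map_add, C_add, add_sub_add_comm]
    exact add_mem hx hy
  | mul x y _ _ hx hy =>
    rw [map_mul, C_mul, show ∀ a b c d : MvPolynomial σ R,
      a * b - c * d = b * (a - c) + c * (b - d) by intros; ring]
    exact add_mem (Ideal.mul_mem_left _ _ hx) (Ideal.mul_mem_left _ _ hy)

/-- let `W` be a finite orthogonal reflection group on `ℝⁿ` with positive
roots given by the nonzero, pairwise non-proportional root vectors `a 1,…,a m` (each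
reflection `s_{αᵢ}` lying in `W`), and let `P₁,…,Pₙ` be basic invariants
(`R^W = ℝ[P₁,…,Pₙ]`) with `∑ (deg Pᵢ − 1) = |Φ⁺|` and nonvanishing Jacobian.
Then the gradients `∇P₁,…,∇Pₙ` form an `R`-basis of the logarithmic derivation module
`D(𝒜_{Φ⁺})` of the Weyl arrangement, and consequently the ideal
`{θ(Q) | θ ∈ D(𝒜_{Φ⁺})}` (with `Q = ∑ xᵢ²` the invariant quadratic form) equals the
ideal generated by the positive-degree `W`-invariants. -/
theorem statement11 (n m : ℕ) (W : Subgroup ((Fin n → ℝ) ≃ₗ[ℝ] (Fin n → ℝ)))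
    [Finite W]
    (horth : ∀ w ∈ W, ∀ x y : Fin n → ℝ, ∑ i, w x i * w y i = ∑ i, x i * y i)
    (a : Fin m → (Fin n → ℝ)) (ha0 : ∀ i, a i ≠ 0)
    (hdist : ∀ i j, i ≠ j → ∀ c : ℝ, a i ≠ c • a j)
    (hrefl : ∀ i, ∃ s ∈ W, ∀ x : Fin n → ℝ,
      s x = x - (2 * (∑ j, a i j * x j) / (∑ j, a i j * a i j)) • a i)
    (P : Fin n → MvPolynomial (Fin n) ℝ) (e : Fin n → ℕ)
    (hPhom : ∀ i, (P i).IsHomogeneous (e i))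
    (hPinv : ∀ i, ∀ w ∈ W, polyAct n w (P i) = P i)
    (hgen : ∀ f : MvPolynomial (Fin n) ℝ,
      (∀ w ∈ W, polyAct n w f = f) ↔ f ∈ Algebra.adjoin ℝ (Set.range P))
    (hdeg : ∑ i : Fin n, (e i - 1) = m)
    (hjac : (Matrix.of fun i j : Fin n => pderiv j (P i)).det ≠ 0) :
    -- the root linear forms
    (∀ (form : Fin m → MvPolynomial (Fin n) ℝ),
      (∀ i, form i = ∑ j : Fin n, C (a i j) * X j) →
      -- (1) the gradients ∇P₁,…,∇Pₙ form an R-basis of D(𝒜_{Φ⁺})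
      (LinearIndependent (MvPolynomial (Fin n) ℝ)
          (fun i : Fin n => fun k : Fin n => pderiv k (P i)) ∧
        (∀ (i : Fin n) (H : Fin m),
          applyDer n (fun k' => pderiv k' (P i)) (form H) ∈ Ideal.span {form H}) ∧
        (∀ η : Fin n → MvPolynomial (Fin n) ℝ,
          (∀ H, applyDer n η (form H) ∈ Ideal.span {form H}) →
          ∃ c : Fin n → MvPolynomial (Fin n) ℝ,
            η = ∑ i : Fin n, c i • (fun k : Fin n => pderiv k (P i)))) ∧
      -- (2) the ideal {θ(Q) | θ ∈ D(𝒜_{Φ⁺})} equals (R^W₊)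
      {g : MvPolynomial (Fin n) ℝ |
          ∃ θ : Fin n → MvPolynomial (Fin n) ℝ,
            (∀ H, applyDer n θ (form H) ∈ Ideal.span {form H}) ∧
            applyDer n θ (∑ j : Fin n, X j ^ 2) = g} =
        ↑(Ideal.span {f : MvPolynomial (Fin n) ℝ |
            (∀ w ∈ W, polyAct n w f = f) ∧ constantCoeff f = 0})) := by
  intro form hform
  obtain rfl : form = fun i => linForm (a i) := funext hform
  have happ : ∀ θ H, applyDer n θ (linForm (a H)) = ∑ k, θ k * C (a H k) := fun θ H =>
    Finset.sum_congr rfl fun k _ => by rw [pderiv_linForm]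
  simp only [Ideal.mem_span_singleton, happ]
  set J := Matrix.of fun i j : Fin n => pderiv j (P i) with hJ
  have hlog : ∀ (i : Fin n) (H : Fin m), linForm (a H) ∣ ∑ k, pderiv k (P i) * C (a H k) := by
    intro i H
    obtain ⟨s, hsW, hs⟩ := hrefl H
    exact linForm_dvd_of_reflection_invariant (ha0 H) hs (hPinv i s hsW)
  have hprod : ∀ f : MvPolynomial (Fin n) ℝ, (∀ H, linForm (a H) ∣ f) →
      ∏ H, linForm (a H) ∣ f := fun f hf =>
    Fintype.prod_dvd_of_isRelPrime
      (fun i j hij => isRelPrime_linForm (ha0 i) (ha0 j) (hdist j i hij.symm)) hf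
  have hprod0 : ∏ H, linForm (a H) ≠ 0 :=
    Finset.prod_ne_zero_iff.2 fun H _ => linForm_ne_zero (ha0 H)
  have hproddeg : (∏ H, linForm (a H)).totalDegree = m := by
    have := (IsHomogeneous.prod Finset.univ (fun H => linForm (a H)) (fun _ => 1)
      fun H _ => isHomogeneous_linForm (a H)).totalDegree hprod0
    simpa using this
  obtain ⟨c, hc⟩ : ∃ c : ℝ, J.det = (∏ H, linForm (a H)) * C c := by
    refine exists_eq_mul_C_of_dvd hprod0
      (hprod _ fun H => dvd_det_of_dvd_mulVec (ha0 H) J fun i => hlog i H) ?_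
    rw [hproddeg, ← hdeg]
    exact (isHomogeneous_det_jacobian hPhom).totalDegree_le
  have hc0 : c ≠ 0 := by
    rintro rfl
    exact hjac (by simpa using hc)
  have hJdvd : ∀ f : MvPolynomial (Fin n) ℝ, (∀ H, linForm (a H) ∣ f) → J.det ∣ f := by
    intro f hf
    rw [hc]
    exact ((hc0.isUnit.map C).mul_right_dvd).2 (hprod f hf)
  have hbasis : ∀ η : Fin n → MvPolynomial (Fin n) ℝ,
      (∀ H, linForm (a H) ∣ ∑ k, η k * C (a H k)) →
      ∃ c : Fin n → MvPolynomial (Fin n) ℝ,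
        η = ∑ i : Fin n, c i • (fun k : Fin n => pderiv k (P i)) := by
    intro η hη
    have hdvd : ∀ i, J.det ∣ (J.updateRow i η).det := by
      refine fun i => hJdvd _ fun H => dvd_det_of_dvd_mulVec (ha0 H) _ fun r => ?_
      by_cases hr : r = i
      · subst hr
        simpa using hη H
      · simpa [hr, hJ] using hlog r H
    choose q hq using hdvd
    refine ⟨q, ?_⟩
    have h1 : J.transpose.mulVec (J.transpose.cramer η) = J.det • η := by
      rw [Matrix.mulVec_cramer, Matrix.det_transpose]
    funext k
    apply mul_left_cancel₀ hjac
    have h2 := congrFun h1 k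
    rw [Pi.smul_apply, smul_eq_mul] at h2
    rw [← h2, Finset.sum_apply, Finset.mul_sum, Matrix.mulVec, dotProduct]
    refine Finset.sum_congr rfl fun i _ => ?_
    rw [Matrix.cramer_transpose_apply, hq i, Pi.smul_apply, smul_eq_mul, Matrix.transpose_apply,
      hJ, Matrix.of_apply]
    ring
  refine ⟨⟨Matrix.linearIndependent_rows_of_det_ne_zero hjac, hlog, hbasis⟩, ?_⟩
  have he : ∀ i, e i ≠ 0 := by
    intro i hi
    refine hjac (Matrix.det_eq_zero_of_row_eq_zero i fun j => ?_)
    have h := hPhom i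
    rw [hi, ← totalDegree_zero_iff_isHomogeneous, totalDegree_eq_zero_iff_eq_C] at h
    change pderiv j (P i) = 0
    rw [h, pderiv_C]
  have hPconst : ∀ i, constantCoeff (P i) = 0 := fun i =>
    (hPhom i).coeff_eq_zero (by simpa using (he i).symm)
  have hQ : ∀ θ, applyDer n θ (∑ j, X j ^ 2) = 2 * ∑ k, θ k * X k := by
    intro θ
    rw [applyDer, Finset.mul_sum]
    refine Finset.sum_congr rfl fun k _ => ?_
    simp [pderiv_X, Pi.single_apply]
    ring
  have hgradQ : ∀ i, ∑ k, pderiv k (P i) * X k = C (e i : ℝ) * P i := by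
    intro i
    have := (hPhom i).sum_X_mul_pderiv
    rw [nsmul_eq_mul] at this
    simpa [mul_comm] using this
  ext g
  simp only [Set.mem_ofPred_eq, SetLike.mem_coe, hQ]
  constructor
  · rintro ⟨θ, hθ, rfl⟩
    obtain ⟨b, rfl⟩ := hbasis θ hθ
    refine Ideal.mul_mem_left _ _ ?_
    have : ∑ k, (∑ i, b i • fun k => pderiv k (P i)) k * X k
        = ∑ i, b i * (C (e i : ℝ) * P i) := by
      simp only [← hgradQ, Finset.sum_apply, Pi.smul_apply, smul_eq_mul, Finset.sum_mul,
        Finset.mul_sum, mul_assoc]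
      exact Finset.sum_comm
    rw [this]
    exact Ideal.sum_mem _ fun i _ => Ideal.mul_mem_left _ _ (Ideal.mul_mem_left _ _
      (Ideal.subset_span ⟨hPinv i, hPconst i⟩))
  · intro hg
    have hle : Ideal.span {f : MvPolynomial (Fin n) ℝ |
        (∀ w ∈ W, polyAct n w f = f) ∧ constantCoeff f = 0} ≤ Ideal.span (Set.range P) := by
      refine Ideal.span_le.2 fun f hf => ?_
      simpa [hf.2] using sub_C_constantCoeff_mem_span (by simpa using hPconst) ((hgen f).1 hf.1)
    obtain ⟨b, rfl⟩ := (Ideal.mem_span_range_iff_exists_fun).1 (hle hg)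
    refine ⟨fun k => ∑ i, b i * C (2 * (e i : ℝ))⁻¹ * pderiv k (P i), fun H => ?_, ?_⟩
    · simp only [Finset.sum_mul]
      rw [Finset.sum_comm]
      refine Finset.dvd_sum fun i _ => ?_
      simp only [mul_assoc, ← Finset.mul_sum]
      exact ((hlog i H).mul_left _).mul_left _
    · simp only [Finset.sum_mul]
      rw [Finset.sum_comm, Finset.mul_sum]
      refine Finset.sum_congr rfl fun i _ => ?_
      simp only [mul_assoc, ← Finset.mul_sum, hgradQ]
      have h1 : (2 : MvPolynomial (Fin n) ℝ) * (C (2 * (e i : ℝ))⁻¹ * C (e i : ℝ)) = 1 := by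
        rw [show (2 : MvPolynomial (Fin n) ℝ) = C 2 from (map_ofNat C 2).symm, ← C_mul, ← C_mul]
        have : (e i : ℝ) ≠ 0 := Nat.cast_ne_zero.2 (he i)
        rw [← C_1]
        congr 1
        field_simp
      linear_combination (b i * P i) * h1
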